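/- Let Λ' → Λ be a surjective ring homomorphism, so that Λ-modules are Λ'-modules via restriction, and assume every projective Λ-module is also projective as a Λ'-module. If M is a Λ-module with pd_Λ M finite, then pd_{Λ'} M = pd_Λ M. -/

import Mathlib

universe u v

/-- `pdLE R n M` : `M` has projective dimension at most `n`. -/
def pdLE (R : Type u) [Ring R] : ℕ → (M : Type v) → [AddCommGroup M] → [Module R M] → Prop
  | 0 => fun M _ _ => Module.Projective R M
  | n+1 => fun M _ _ => ∃ (P : Type v) (_ : AddCommGroup P) (_ : Module R P)
      (f : P →ₗ[R] M), Module.Projective R P ∧ Function.Surjective f ∧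
        pdLE R n (LinearMap.ker f)

/-- The projective dimension of `M` as an element of `ℕ∞` (`⊤` = infinite). -/
noncomputable def pd (R : Type u) [Ring R] (M : Type v) [AddCommGroup M] [Module R M] : ℕ∞ :=
  sInf {d : ℕ∞ | ∃ n : ℕ, d = (n : ℕ∞) ∧ pdLE R n M}

theorem pdLE_equiv {R : Type u} [Ring R] (n : ℕ) {M N : Type v} [AddCommGroup M] [Module R M]
    [AddCommGroup N] [Module R N] (e : M ≃ₗ[R] N) (h : pdLE R n M) : pdLE R n N := by
  cases n with
  | zero =>
    have h' : Module.Projective R M := h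
    exact Module.Projective.of_equiv e
  | succ n =>
    obtain ⟨P, i1, i2, f, hP, hf, hk⟩ := h
    refine ⟨P, i1, i2, e.toLinearMap ∘ₗ f, hP, e.surjective.comp hf, ?_⟩
    rw [LinearEquiv.ker_comp]
    exact hk

theorem pdLE_succ_of_projective {R : Type u} [Ring R] (n : ℕ) {M : Type v} [AddCommGroup M]
    [Module R M] (h : Module.Projective R M) : pdLE R n M := by
  induction n generalizing M with
  | zero => exact h
  | succ n ih =>
    refine ⟨M, _, _, LinearMap.id, h, Function.surjective_id, ih ?_⟩
    rw [LinearMap.ker_id]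
    infer_instance

theorem pdLE_prod {R : Type u} [Ring R] (n : ℕ) {M Q : Type v} [AddCommGroup M] [Module R M]
    [AddCommGroup Q] [Module R Q] (hQ : Module.Projective R Q) (h : pdLE R n M) :
    pdLE R n (M × Q) := by
  cases n with
  | zero =>
    have h' : Module.Projective R M := h
    exact (inferInstance : Module.Projective R (M × Q))
  | succ n =>
    obtain ⟨P, i1, i2, f, hP, hf, hk⟩ := h
    refine ⟨P × Q, _, _, f.prodMap LinearMap.id, inferInstance,
      Function.Surjective.prodMap hf Function.surjective_id, ?_⟩
    refine pdLE_equiv n (M := LinearMap.ker f) ?_ hk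
    exact
      { toFun := fun x => ⟨(x.1, 0), by simp⟩
        invFun := fun x => ⟨x.1.1, by
          have := x.2
          rw [LinearMap.mem_ker] at this
          exact congrArg Prod.fst this⟩
        map_add' := fun x y => by ext <;> simp
        map_smul' := fun x y => by ext <;> simp
        left_inv := fun x => rfl
        right_inv := fun x => by
          have := x.2
          rw [LinearMap.mem_ker] at this
          have h2 : x.1.2 = 0 := congrArg Prod.snd this
          ext
          · rfl
          · exact h2.symm }

noncomputable def splitEquiv {R : Type u} [Ring R] {E Q : Type v} [AddCommGroup E] [Module R E]
    [AddCommGroup Q] [Module R Q] (g : E →ₗ[R] Q) (s : Q →ₗ[R] E) (hs : ∀ q, g (s q) = q) :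
    E ≃ₗ[R] (LinearMap.ker g × Q) where
  toFun x := (⟨x - s (g x), by simp [hs]⟩, g x)
  invFun y := y.1 + s y.2
  map_add' x y := by
    ext
    · simp; abel
    · simp
  map_smul' x y := by
    ext
    · simp [smul_sub]
    · simp
  left_inv x := by simp
  right_inv y := by
    have := LinearMap.mem_ker.1 y.1.2
    ext <;> simp [hs, this]

theorem exists_splitEquiv {R : Type u} [Ring R] {E Q : Type v} [AddCommGroup E] [Module R E]
    [AddCommGroup Q] [Module R Q] (g : E →ₗ[R] Q) (hg : Function.Surjective g)
    (hQ : Module.Projective R Q) :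
    Nonempty (E ≃ₗ[R] (LinearMap.ker g × Q)) := by
  obtain ⟨s, hs⟩ := Module.projective_lifting_property g LinearMap.id hg
  exact ⟨splitEquiv g s (fun q => LinearMap.congr_fun hs q)⟩

theorem projective_ker {R : Type u} [Ring R] {E Q : Type v} [AddCommGroup E] [Module R E]
    [AddCommGroup Q] [Module R Q] (g : E →ₗ[R] Q) (hg : Function.Surjective g)
    (hQ : Module.Projective R Q) (hE : Module.Projective R E) :
    Module.Projective R (LinearMap.ker g) := by
  obtain ⟨e⟩ := exists_splitEquiv g hg hQ
  refine Module.Projective.of_split (e.symm.toLinearMap ∘ₗ LinearMap.inl R _ _)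
    (LinearMap.fst R _ _ ∘ₗ e.toLinearMap) ?_
  ext x
  simp

theorem pdLE_ker {R : Type u} [Ring R] (n : ℕ) {E Q : Type v} [AddCommGroup E] [Module R E]
    [AddCommGroup Q] [Module R Q] (g : E →ₗ[R] Q) (hg : Function.Surjective g)
    (hQ : Module.Projective R Q) (h : pdLE R n E) : pdLE R n (LinearMap.ker g) := by
  cases n with
  | zero => exact projective_ker g hg hQ h
  | succ n =>
    obtain ⟨P, i1, i2, f, hP, hf, hk⟩ := h
    refine ⟨LinearMap.ker (g ∘ₗ f), _, _,
      f.restrict (p := LinearMap.ker (g ∘ₗ f)) (q := LinearMap.ker g) (fun x hx => hx),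
      projective_ker (g ∘ₗ f) (hg.comp hf) hQ hP, ?_, ?_⟩
    · rintro ⟨y, hy⟩
      obtain ⟨x, rfl⟩ := hf y
      exact ⟨⟨x, hy⟩, rfl⟩
    · refine pdLE_equiv n (M := LinearMap.ker f) ?_ hk
      exact
        { toFun := fun x => ⟨⟨x.1, by simp [LinearMap.mem_ker.1 x.2]⟩, by
            rw [LinearMap.mem_ker]
            exact Subtype.ext x.2⟩
          invFun := fun x => ⟨x.1.1, congrArg Subtype.val (LinearMap.mem_ker.1 x.2)⟩
          map_add' := fun x y => rfl
          map_smul' := fun x y => rfl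
          left_inv := fun x => rfl
          right_inv := fun x => rfl }

/-- Dimension shifting, through Schanuel's lemma. -/
theorem pdLE_shift {R : Type u} [Ring R] (n : ℕ) {M P : Type v} [AddCommGroup M] [Module R M]
    [AddCommGroup P] [Module R P] (f : P →ₗ[R] M) (hf : Function.Surjective f)
    (hP : Module.Projective R P) (h : pdLE R (n + 1) M) : pdLE R n (LinearMap.ker f) := by
  obtain ⟨P', i1, i2, f', hP', hf', hk⟩ := h
  let E := LinearMap.eqLocus (f ∘ₗ LinearMap.fst R P P') (f' ∘ₗ LinearMap.snd R P P')
  have hE : ∀ x : E, f x.1.1 = f' x.1.2 := fun x => x.2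
  let g : E →ₗ[R] P := LinearMap.fst R P P' ∘ₗ E.subtype
  let g' : E →ₗ[R] P' := LinearMap.snd R P P' ∘ₗ E.subtype
  have hg : Function.Surjective g := fun p => by
    obtain ⟨q, hq⟩ := hf' (f p)
    exact ⟨⟨(p, q), hq.symm⟩, rfl⟩
  have hg' : Function.Surjective g' := fun q => by
    obtain ⟨p, hp⟩ := hf (f' q)
    exact ⟨⟨(p, q), hp⟩, rfl⟩
  have h1 : pdLE R n (LinearMap.ker g) := by
    refine pdLE_equiv n (M := LinearMap.ker f') ?_ hk
    exact
      { toFun := fun x => ⟨⟨(0, x.1), show f 0 = f' x.1 by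
          rw [LinearMap.mem_ker.1 x.2, map_zero]⟩, rfl⟩
        invFun := fun x => ⟨x.1.1.2, by
          have h0 : x.1.1.1 = 0 := x.2
          rw [LinearMap.mem_ker, ← hE, h0, map_zero]⟩
        map_add' := fun x y => by ext <;> simp
        map_smul' := fun x y => by ext <;> simp
        left_inv := fun x => rfl
        right_inv := fun x => by
          have h0 : x.1.1.1 = 0 := x.2
          ext
          · exact h0.symm
          · rfl }
  obtain ⟨e⟩ := exists_splitEquiv g hg hP
  have h2 : pdLE R n E := pdLE_equiv n e.symm (pdLE_prod n hP h1)
  refine pdLE_equiv n (M := LinearMap.ker g') ?_ (pdLE_ker n g' hg' hP' h2)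
  exact
    { toFun := fun x => ⟨x.1.1.1, by
        have h0 : x.1.1.2 = 0 := x.2
        rw [LinearMap.mem_ker, hE, h0, map_zero]⟩
      invFun := fun x => ⟨⟨(x.1, 0), show f x.1 = f' 0 by
          rw [LinearMap.mem_ker.1 x.2, map_zero]⟩, rfl⟩
      map_add' := fun x y => rfl
      map_smul' := fun x y => rfl
      left_inv := fun x => by
        have h0 : x.1.1.2 = 0 := x.2
        ext
        · rfl
        · exact h0.symm
      right_inv := fun x => rfl }

/-- Restriction of a linear map along a ring homomorphism. -/
def resMap {S R : Type u} [Ring S] [Ring R] (φ : S →+* R) {M N : Type v}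
    [AddCommGroup M] [Module R M] [Module S M] [AddCommGroup N] [Module R N] [Module S N]
    (hM : ∀ (a : S) (m : M), a • m = φ a • m) (hN : ∀ (a : S) (m : N), a • m = φ a • m)
    (f : M →ₗ[R] N) : M →ₗ[S] N where
  toFun := f
  map_add' := map_add f
  map_smul' a m := by simp [hM, hN]

def resKer {S R : Type u} [Ring S] [Ring R] (φ : S →+* R) {M N : Type v}
    [AddCommGroup M] [Module R M] [Module S M] [AddCommGroup N] [Module R N] [Module S N]
    (hM : ∀ (a : S) (m : M), a • m = φ a • m) (hN : ∀ (a : S) (m : N), a • m = φ a • m)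
    (f : M →ₗ[R] N) [Module S (LinearMap.ker f)]
    (hK : ∀ (a : S) (m : LinearMap.ker f), a • m = φ a • m) :
    LinearMap.ker f ≃ₗ[S] LinearMap.ker (resMap φ hM hN f) where
  toFun x := ⟨x.1, x.2⟩
  invFun x := ⟨x.1, x.2⟩
  map_add' x y := rfl
  map_smul' a x := by
    ext
    simp [hK, hM]
  left_inv x := rfl
  right_inv x := rfl

theorem pdLE_res {S R : Type u} [Ring S] [Ring R] (φ : S →+* R)
    (hproj : ∀ (P : Type v) [AddCommGroup P] [Module R P] [Module S P],
      (∀ (a : S) (m : P), a • m = φ a • m) → Module.Projective R P → Module.Projective S P)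
    (n : ℕ) (M : Type v) [AddCommGroup M] [Module R M] [Module S M]
    (hM : ∀ (a : S) (m : M), a • m = φ a • m) (h : pdLE R n M) : pdLE S n M := by
  induction n generalizing M with
  | zero => exact hproj M hM h
  | succ n ih =>
    obtain ⟨P, i1, i2, f, hP, hf, hk⟩ := h
    letI := Module.compHom P φ
    have hPc : ∀ (a : S) (m : P), a • m = φ a • m := fun _ _ => rfl
    letI := Module.compHom (LinearMap.ker f) φ
    have hKc : ∀ (a : S) (m : LinearMap.ker f), a • m = φ a • m := fun _ _ => rfl
    exact ⟨P, i1, _, resMap φ hPc hM f, hproj P hPc hP, hf,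
      pdLE_equiv n (resKer φ hPc hM f hKc) (ih _ hKc hk)⟩

theorem pdLE_desc {S R : Type u} [Ring S] [Ring R] (φ : S →+* R) (hφ : Function.Surjective φ)
    (hproj : ∀ (P : Type v) [AddCommGroup P] [Module R P] [Module S P],
      (∀ (a : S) (m : P), a • m = φ a • m) → Module.Projective R P → Module.Projective S P)
    (m n : ℕ) (M : Type v) [AddCommGroup M] [Module R M] [Module S M]
    (hM : ∀ (a : S) (m : M), a • m = φ a • m) (h : pdLE R n M) (h' : pdLE S m M) :
    pdLE R m M := by
  induction m generalizing M n with
  | zero =>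
    have hp : Module.Projective S M := h'
    letI := Module.compHom (M →₀ R) φ
    have hF : ∀ (a : S) (m : M →₀ R), a • m = φ a • m := fun _ _ => rfl
    let f : (M →₀ R) →ₗ[R] M := Finsupp.linearCombination R id
    have hf : Function.Surjective f := fun x => ⟨Finsupp.single x 1, by simp [f]⟩
    let f' : (M →₀ R) →ₗ[S] M :=
      { toFun := f, map_add' := map_add f, map_smul' := fun a m => by simp [hM, hF] }
    obtain ⟨s, hs⟩ := Module.projective_lifting_property f' LinearMap.id hf
    let s' : M →ₗ[R] (M →₀ R) :=
      { toFun := s, map_add' := map_add s, map_smul' := fun a m => by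
          obtain ⟨b, rfl⟩ := hφ a
          rw [← hM, map_smul, hF]; rfl }
    exact Module.Projective.of_split s' f (LinearMap.ext fun x => LinearMap.congr_fun hs x)
  | succ m ih =>
    cases n with
    | zero => exact pdLE_succ_of_projective _ h
    | succ n =>
      obtain ⟨P, i1, i2, f, hP, hf, hk⟩ := h
      letI := Module.compHom P φ
      have hPc : ∀ (a : S) (m : P), a • m = φ a • m := fun _ _ => rfl
      letI := Module.compHom (LinearMap.ker f) φ
      have hKc : ∀ (a : S) (m : LinearMap.ker f), a • m = φ a • m := fun _ _ => rfl
      refine ⟨P, i1, i2, f, hP, hf, ih n _ hKc hk ?_⟩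
      exact pdLE_equiv m (resKer φ hPc hM f hKc).symm
        (pdLE_shift m (resMap φ hPc hM f) hf (hproj P hPc hP) h')

theorem stmt6 (Λ' Λ : Type u) [Ring Λ'] [Ring Λ] (φ : Λ' →+* Λ)
    (hφ : Function.Surjective φ)
    (hproj : ∀ (P : Type v) [AddCommGroup P] [Module Λ P], Module.Projective Λ P →
      letI := Module.compHom P φ; Module.Projective Λ' P)
    (M : Type v) [AddCommGroup M] [Module Λ M]
    (hfin : pd Λ M ≠ ⊤) :
    letI := Module.compHom M φ; pd Λ' M = pd Λ M := by
  letI := Module.compHom M φ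
  have hM : ∀ (a : Λ') (m : M), a • m = φ a • m := fun _ _ => rfl
  have hproj' : ∀ (P : Type v) [AddCommGroup P] [Module Λ P] [Module Λ' P],
      (∀ (a : Λ') (m : P), a • m = φ a • m) → Module.Projective Λ P →
        Module.Projective Λ' P := by
    intro P _ _ i hc hP
    have : i = Module.compHom P φ := Module.ext' _ _ hc
    subst this
    exact hproj P hP
  have hex : ∃ n, pdLE Λ n M := by
    by_contra hne
    push Not at hne
    apply hfin
    rw [pd, sInf_eq_top]
    rintro d ⟨n, -, hn⟩
    exact absurd hn (hne n)
  obtain ⟨n, hn⟩ := hex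
  have key : ∀ k, pdLE Λ' k M ↔ pdLE Λ k M := fun k =>
    ⟨pdLE_desc φ hφ hproj' k n M hM hn, pdLE_res φ hproj' k M hM⟩
  show pd Λ' M = pd Λ M
  simp only [pd, key]
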